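/- arXiv:0712.3736 — 3 statements merged into one kernel-verified Lean document; each statement's English description precedes it below -/
import Mathlib

section
/- Let P be a finite, non-collinear subset of the Euclidean plane ℝ². Then the Voronoi vertex set 𝒱(P) is finite and, as integers, (𝒱(P)).ncard = 2·(P.ncard) − (Bd(P)).ncard − I_c(P) − 2. -/
open Set

abbrev Plane : Type := EuclideanSpace ℝ (Fin 2)

/-- The Voronoi cell of a generator `p` for a generating set `P`. -/
def cell (P : Set Plane) (p : Plane) : Set Plane :=
  {x : Plane | ∀ q ∈ P, dist x p ≤ dist x q}

/-- The set of nearest generators of `x` in `P`. -/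
def nearest (P : Set Plane) (x : Plane) : Set Plane :=
  {p ∈ P | ∀ q ∈ P, dist x p ≤ dist x q}

/-- The Voronoi vertex set: points with at least 3 nearest generators. -/
def vtx (P : Set Plane) : Set Plane :=
  {x : Plane | 3 ≤ (nearest P x).encard}

/-- The boundary of a point set: its points on the frontier of its convex hull. -/
def Bd (S : Set Plane) : Set Plane :=
  S ∩ frontier (convexHull ℝ S)

/-- The number of instances of cocircularity. -/
noncomputable def Ic (P : Set Plane) : ℤ :=
  ∑ᶠ x ∈ vtx P, (((nearest P x).ncard : ℤ) - 3)

open Filter Topology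

/-- Coordinate in the direction `(1, s)`, up to scale. -/
noncomputable def hor (s : ℝ) (x : Plane) : ℝ := x 0 + s * x 1

/-- Coordinate in the direction `(-s, 1)`, orthogonal to that of `hor s`, up to scale. -/
noncomputable def ver (s : ℝ) (x : Plane) : ℝ := x 1 - s * x 0

/-- The point with prescribed `hor s` and `ver s` coordinates. -/
noncomputable def pt (s a b : ℝ) : Plane :=
  !₂[(a - s * b) / (1 + s ^ 2), (s * a + b) / (1 + s ^ 2)]

/-- The vector with coordinates `(a, b)` lies in the normal cone of the convex hull of `P` at `p`. -/
def IsNormal (s : ℝ) (P : Set Plane) (p : Plane) (a b : ℝ) : Prop :=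
  ∀ q ∈ P, a * (hor s q - hor s p) + b * (ver s q - ver s p) ≤ 0

/-- `x` maximizes `σ * ver s` on the Voronoi cell of `p`. -/
def IsExt (s : ℝ) (P : Set Plane) (σ : ℝ) (p x : Plane) : Prop :=
  x ∈ cell P p ∧ ∀ y ∈ cell P p, σ * ver s y ≤ σ * ver s x

@[simp] lemma hor_pt (s a b : ℝ) : hor s (pt s a b) = a := by
  have : 1 + s ^ 2 ≠ 0 := by positivity
  simp only [hor, pt, PiLp.toLp_apply, Matrix.cons_val_zero, Matrix.cons_val_one]
  field_simp
  ring

@[simp] lemma ver_pt (s a b : ℝ) : ver s (pt s a b) = b := by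
  have : 1 + s ^ 2 ≠ 0 := by positivity
  simp only [ver, pt, PiLp.toLp_apply, Matrix.cons_val_zero, Matrix.cons_val_one]
  field_simp
  ring

lemma eq_of_hor_of_ver {s : ℝ} {x y : Plane} (h : hor s x = hor s y) (v : ver s x = ver s y) :
    x = y := by
  have hs : 1 + s ^ 2 ≠ 0 := by positivity
  simp only [hor, ver] at h v
  have h0 : x 0 = y 0 := mul_left_cancel₀ hs (by linear_combination h - s * v)
  have h1 : x 1 = y 1 := mul_left_cancel₀ hs (by linear_combination s * h + v)
  ext i
  fin_cases i
  · exact h0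
  · exact h1

lemma pt_hor_ver (s : ℝ) (x : Plane) : pt s (hor s x) (ver s x) = x :=
  eq_of_hor_of_ver (s := s) (by simp) (by simp)

@[fun_prop] lemma continuous_hor (s : ℝ) : Continuous (hor s) := by unfold hor; fun_prop

@[fun_prop] lemma continuous_ver (s : ℝ) : Continuous (ver s) := by unfold ver; fun_prop

lemma dist_le_dist_iff (s : ℝ) (x p q : Plane) :
    dist x p ≤ dist x q ↔ (hor s x - hor s p) ^ 2 + (ver s x - ver s p) ^ 2 ≤
      (hor s x - hor s q) ^ 2 + (ver s x - ver s q) ^ 2 := by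
  have hs : 0 < 1 + s ^ 2 := by positivity
  have key : ∀ y : Plane, (hor s x - hor s y) ^ 2 + (ver s x - ver s y) ^ 2 =
      (1 + s ^ 2) * dist x y ^ 2 := by
    intro y
    rw [EuclideanSpace.dist_sq_eq, Fin.sum_univ_two, Real.dist_eq, Real.dist_eq, sq_abs, sq_abs]
    simp only [hor, ver]
    ring
  rw [key, key, mul_le_mul_iff_right₀ hs, sq_le_sq₀ dist_nonneg dist_nonneg]

lemma mem_cell_iff (s : ℝ) {P : Set Plane} {p x : Plane} :
    x ∈ cell P p ↔ ∀ q ∈ P,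
      2 * ((hor s x - hor s p) * (hor s q - hor s p) + (ver s x - ver s p) * (ver s q - ver s p)) ≤
        (hor s q - hor s p) ^ 2 + (ver s q - ver s p) ^ 2 := by
  refine forall₂_congr fun q _ => ?_
  rw [dist_le_dist_iff s]
  constructor <;> intro h <;> linarith

lemma isClosed_cell (P : Set Plane) (p : Plane) : IsClosed (cell P p) := by
  have : cell P p = ⋂ q ∈ P, {x | dist x p ≤ dist x q} := by ext; simp [cell]
  rw [this]
  exact isClosed_biInter fun q _ => isClosed_le (by fun_prop) (by fun_prop)

lemma self_mem_cell (P : Set Plane) (p : Plane) : p ∈ cell P p := fun q _ => by simp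

lemma dist_eq_of_mem_nearest {P : Set Plane} {p q x : Plane} (hp : p ∈ nearest P x)
    (hq : q ∈ nearest P x) : dist x p = dist x q :=
  le_antisymm (hp.2 q hq.1) (hq.2 p hp.1)

lemma exists_hor_injOn {P : Set Plane} (hP : P.Finite) : ∃ s : ℝ, InjOn (hor s) P := by
  have hfin : ((fun d : Plane × Plane => -(d.1 0 - d.2 0) / (d.1 1 - d.2 1)) '' (P ×ˢ P)).Finite :=
    (hP.prod hP).image _
  obtain ⟨s, hs⟩ := (hfin.insert 0).exists_notMem
  rw [mem_insert_iff, not_or] at hs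
  refine ⟨s, fun p hp q hq h => ?_⟩
  simp only [hor] at h
  by_cases h1 : p 1 = q 1
  · have h0 : p 0 = q 0 := by rw [h1] at h; linarith
    ext i
    fin_cases i
    · exact h0
    · exact h1
  · refine absurd ⟨(p, q), ⟨hp, hq⟩, ?_⟩ hs.2
    have : p 1 - q 1 ≠ 0 := sub_ne_zero.2 h1
    simp only
    field_simp
    linarith

/-- A small perturbation of a horizontal direction stays inside the Voronoi cell. -/
lemma eventually_pt_mem_cell {s : ℝ} {P : Set Plane} (hP : P.Finite) {p x : Plane}
    (hx : x ∈ cell P p) (τ σ : ℝ)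
    (h : ∀ q ∈ nearest P x, q ≠ p → τ * (hor s q - hor s p) < 0) :
    ∀ᶠ ε in 𝓝[>] (0 : ℝ), pt s (hor s x + ε * τ) (ver s x + ε ^ 2 * σ) ∈ cell P p := by
  simp only [mem_cell_iff s, hor_pt, ver_pt]
  rw [eventually_all_finite hP]
  intro q hq
  by_cases hqp : q = p
  · subst hqp
    simp
  by_cases hn : q ∈ nearest P x
  · have hc : Tendsto (fun ε : ℝ => τ * (hor s q - hor s p) + ε * (σ * (ver s q - ver s p)))
        (𝓝[>] 0) (𝓝 (τ * (hor s q - hor s p) + 0 * (σ * (ver s q - ver s p)))) :=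
      Continuous.tendsto (by fun_prop) 0 |>.mono_left nhdsWithin_le_nhds
    rw [zero_mul, add_zero] at hc
    filter_upwards [hc.eventually_lt_const (h q hn hqp), self_mem_nhdsWithin] with ε hε h0
    have h1 := (mem_cell_iff s).1 hx q hq
    have h2 := mul_neg_of_pos_of_neg (mem_Ioi.1 h0) hε
    nlinarith
  · have hlt : dist x p < dist x q := by
      by_contra hcon
      exact hn ⟨hq, fun r hr => (not_lt.1 hcon).trans (hx r hr)⟩
    have h1 := not_le.2 hlt
    rw [dist_le_dist_iff s, not_le] at h1
    have hc : Tendsto (fun ε : ℝ => 2 * ((hor s x + ε * τ - hor s p) * (hor s q - hor s p) +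
        (ver s x + ε ^ 2 * σ - ver s p) * (ver s q - ver s p)))
        (𝓝[>] 0) (𝓝 (2 * ((hor s x + 0 * τ - hor s p) * (hor s q - hor s p) +
        (ver s x + 0 ^ 2 * σ - ver s p) * (ver s q - ver s p)))) :=
      Continuous.tendsto (by fun_prop) 0 |>.mono_left nhdsWithin_le_nhds
    refine (hc.eventually_lt_const ?_).mono fun ε => le_of_lt
    nlinarith

/-- A horizontal normal at a strictly extremal point can be perturbed. -/
lemma exists_isNormal_of_strict {s : ℝ} {P : Set Plane} (hP : P.Finite) {p : Plane} (τ σ : ℝ)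
    (h : ∀ q ∈ P, q ≠ p → τ * (hor s q - hor s p) < 0) :
    ∃ ε > 0, IsNormal s P p τ (ε * σ) := by
  have : ∀ᶠ ε in 𝓝[>] (0 : ℝ), IsNormal s P p τ (ε * σ) := by
    unfold IsNormal
    rw [eventually_all_finite hP]
    intro q hq
    by_cases hqp : q = p
    · subst hqp
      simp
    have hc : Tendsto (fun ε : ℝ => τ * (hor s q - hor s p) + ε * σ * (ver s q - ver s p))
        (𝓝[>] 0) (𝓝 (τ * (hor s q - hor s p) + 0 * σ * (ver s q - ver s p))) :=
      Continuous.tendsto (by fun_prop) 0 |>.mono_left nhdsWithin_le_nhds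
    rw [zero_mul, zero_mul, add_zero] at hc
    exact (hc.eventually_lt_const (h q hq hqp)).mono fun ε => le_of_lt
  obtain ⟨ε, h1, h2⟩ := (this.and self_mem_nhdsWithin).exists
  exact ⟨ε, h2, h1⟩

/-- Three nearest generators are cocircular, so the one in the horizontal middle is off the chord
of the other two, and its cell meets the horizontal line only at `x`. -/
lemma strict_of_hor_between {s : ℝ} {P : Set Plane} {p q₁ q₂ x : Plane}
    (hp : p ∈ nearest P x) (h₁ : q₁ ∈ nearest P x) (h₂ : q₂ ∈ nearest P x)
    (hlt₁ : hor s q₁ < hor s p) (hlt₂ : hor s p < hor s q₂) :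
    (∀ y ∈ cell P p, y ≠ x → ver s y < ver s x) ∨ (∀ y ∈ cell P p, y ≠ x → ver s x < ver s y) := by
  have e₁ := (dist_le_dist_iff s _ _ _).1 (dist_eq_of_mem_nearest hp h₁).le
  have e₁' := (dist_le_dist_iff s _ _ _).1 (dist_eq_of_mem_nearest hp h₁).ge
  have e₂ := (dist_le_dist_iff s _ _ _).1 (dist_eq_of_mem_nearest hp h₂).le
  have e₂' := (dist_le_dist_iff s _ _ _).1 (dist_eq_of_mem_nearest hp h₂).ge
  have E₁ := le_antisymm e₁ e₁'
  have E₂ := le_antisymm e₂ e₂'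
  clear e₁ e₁' e₂ e₂'
  have hy : ∀ y ∈ cell P p, ∀ q ∈ nearest P x, (hor s y - hor s x) * (hor s q - hor s p) +
      (ver s y - ver s x) * (ver s q - ver s p) ≤ 0 := by
    intro y hy q hq
    have a := (dist_le_dist_iff s _ _ _).1 (hy q hq.1)
    have b := (dist_le_dist_iff s _ _ _).1 (dist_eq_of_mem_nearest hp hq).ge
    linarith
  set K := (hor s q₂ - hor s p) * (ver s q₁ - ver s p) +
    (hor s p - hor s q₁) * (ver s q₂ - ver s p) with hK
  have hK0 : K ≠ 0 := by
    intro h0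
    have hpos : 0 < (hor s q₂ - hor s p) * ((hor s q₁ - hor s p) ^ 2 + (ver s q₁ - ver s p) ^ 2) +
        (hor s p - hor s q₁) * ((hor s q₂ - hor s p) ^ 2 + (ver s q₂ - ver s p) ^ 2) := by
      have t₁ : 0 < hor s q₂ - hor s p := by linarith
      have t₂ : 0 < hor s p - hor s q₁ := by linarith
      have t₃ : hor s q₁ - hor s p ≠ 0 := by linarith
      positivity
    have : (hor s q₂ - hor s p) * ((hor s q₁ - hor s p) ^ 2 + (ver s q₁ - ver s p) ^ 2) +
        (hor s p - hor s q₁) * ((hor s q₂ - hor s p) ^ 2 + (ver s q₂ - ver s p) ^ 2) = 0 := by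
      linear_combination (-(hor s q₂ - hor s p)) * E₁ - (hor s p - hor s q₁) * E₂ +
        2 * (ver s x - ver s p) * h0
    linarith
  have hprod : ∀ y ∈ cell P p, (ver s y - ver s x) * K ≤ 0 := by
    intro y hyc
    have a := mul_le_mul_of_nonneg_left (hy y hyc q₁ h₁) (sub_pos.2 hlt₂).le
    have b := mul_le_mul_of_nonneg_left (hy y hyc q₂ h₂) (sub_pos.2 hlt₁).le
    nlinarith
  have hne : ∀ y ∈ cell P p, y ≠ x → ver s y ≠ ver s x := by
    intro y hyc hyx hv
    have a := hy y hyc q₁ h₁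
    have b := hy y hyc q₂ h₂
    rw [hv, sub_self, zero_mul, add_zero] at a b
    refine hyx (eq_of_hor_of_ver (s := s) (le_antisymm ?_ ?_) hv)
    · by_contra hcon
      nlinarith
    · by_contra hcon
      nlinarith
  rcases lt_or_gt_of_ne hK0 with hneg | hpos
  · refine Or.inr fun y hyc hyx => lt_of_le_of_ne ?_ (hne y hyc hyx).symm
    have := hprod y hyc
    by_contra hcon
    nlinarith
  · refine Or.inl fun y hyc hyx => lt_of_le_of_ne ?_ (hne y hyc hyx)
    have := hprod y hyc
    by_contra hcon
    nlinarith

lemma exists_hor_extremes {s : ℝ} {N : Set Plane} (hN : N.Finite) (hinj : InjOn (hor s) N)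
    (hne : N.Nontrivial) : ∃ m ∈ N, ∃ M ∈ N, m ≠ M ∧
      (∀ q ∈ N, q ≠ m → hor s m < hor s q) ∧ (∀ q ∈ N, q ≠ M → hor s q < hor s M) := by
  obtain ⟨m, hm, hm'⟩ := exists_min_image N (hor s) hN hne.nonempty
  obtain ⟨M, hM, hM'⟩ := exists_max_image N (hor s) hN hne.nonempty
  have h₁ : ∀ q ∈ N, q ≠ m → hor s m < hor s q := fun q hq hqm =>
    lt_of_le_of_ne (hm' q hq) fun h => hqm (hinj hq hm h.symm)
  have h₂ : ∀ q ∈ N, q ≠ M → hor s q < hor s M := fun q hq hqM =>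
    lt_of_le_of_ne (hM' q hq) fun h => hqM (hinj hq hM h)
  refine ⟨m, hm, M, hM, ?_, h₁, h₂⟩
  rintro rfl
  obtain ⟨q, hq, hqm⟩ := hne.exists_ne m
  exact lt_asymm (h₁ q hq hqm) (h₂ q hq hqm)

lemma not_isExt_of_strict {s : ℝ} {P : Set Plane} (hP : P.Finite) {p x : Plane} {σ : ℝ}
    (hσ : σ ≠ 0) (τ : ℝ) (h : ∀ q ∈ nearest P x, q ≠ p → τ * (hor s q - hor s p) < 0) :
    ¬ IsExt s P σ p x := by
  rintro ⟨hx, hmax⟩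
  obtain ⟨ε, h1, h2⟩ :=
    ((eventually_pt_mem_cell hP hx τ σ h).and self_mem_nhdsWithin).exists
  have h3 := hmax _ h1
  rw [ver_pt] at h3
  have h4 : (0 : ℝ) < ε := h2
  have : 0 < ε ^ 2 * σ ^ 2 := by positivity
  nlinarith

lemma IsExt.exists_between {s : ℝ} {P : Set Plane} (hP : P.Finite) (hinj : InjOn (hor s) P)
    {p x : Plane} (hp : p ∈ P) {σ : ℝ} (hσ : σ ≠ 0) (h : IsExt s P σ p x) :
    ∃ q₁ ∈ nearest P x, ∃ q₂ ∈ nearest P x, hor s q₁ < hor s p ∧ hor s p < hor s q₂ := by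
  have h₁ : ∃ q ∈ nearest P x, hor s q < hor s p := by
    by_contra! hcon
    refine not_isExt_of_strict hP hσ (-1) (fun q hq hqp => ?_) h
    have := lt_of_le_of_ne (hcon q hq) fun e => hqp (hinj hq.1 hp e.symm)
    linarith
  have h₂ : ∃ q ∈ nearest P x, hor s p < hor s q := by
    by_contra! hcon
    refine not_isExt_of_strict hP hσ 1 (fun q hq hqp => ?_) h
    have := lt_of_le_of_ne (hcon q hq) fun e => hqp (hinj hq.1 hp e)
    linarith
  obtain ⟨q₁, hq₁, hlt₁⟩ := h₁
  obtain ⟨q₂, hq₂, hlt₂⟩ := h₂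
  exact ⟨q₁, hq₁, q₂, hq₂, hlt₁, hlt₂⟩

lemma IsExt.unique {s : ℝ} {P : Set Plane} (hP : P.Finite) (hinj : InjOn (hor s) P)
    {p x y : Plane} (hp : p ∈ P) {σ : ℝ} (hσ : σ ≠ 0) (hx : IsExt s P σ p x)
    (hy : IsExt s P σ p y) : y = x := by
  obtain ⟨q₁, hq₁, q₂, hq₂, hlt₁, hlt₂⟩ := hx.exists_between hP hinj hp hσ
  have hv : ver s y = ver s x :=
    mul_left_cancel₀ hσ (le_antisymm (hx.2 y hy.1) (hy.2 x hx.1))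
  by_contra hne
  rcases strict_of_hor_between ⟨hp, hx.1⟩ hq₁ hq₂ hlt₁ hlt₂ with h | h
  · exact (h y hy.1 hne).ne hv
  · exact (h y hy.1 hne).ne hv.symm

lemma IsExt.not_neg {s : ℝ} {P : Set Plane} (hP : P.Finite) (hinj : InjOn (hor s) P)
    {p x : Plane} (hp : p ∈ P) (h : IsExt s P 1 p x) : ¬ IsExt s P (-1) p x := by
  intro h'
  obtain ⟨q₁, hq₁, q₂, hq₂, hlt₁, hlt₂⟩ := h.exists_between hP hinj hp one_ne_zero
  have hpn : p ∈ nearest P x := ⟨hp, h.1⟩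
  have hv : ver s p = ver s x := by
    have h1 := h.2 p (self_mem_cell P p)
    have h2 := h'.2 p (self_mem_cell P p)
    linarith
  have hpx : p = x := by
    by_contra hne
    rcases strict_of_hor_between hpn hq₁ hq₂ hlt₁ hlt₂ with h | h
    · exact (h p (self_mem_cell P p) hne).ne hv
    · exact (h p (self_mem_cell P p) hne).ne hv.symm
  have hd := dist_eq_of_mem_nearest hpn hq₁
  rw [hpx, dist_self] at hd
  rw [hpx, ← dist_eq_zero.1 hd.symm] at hlt₁
  exact lt_irrefl _ hlt₁

lemma isExt_or_of_between {s : ℝ} {P : Set Plane} {p q₁ q₂ x : Plane}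
    (hp : p ∈ nearest P x) (h₁ : q₁ ∈ nearest P x) (h₂ : q₂ ∈ nearest P x)
    (hlt₁ : hor s q₁ < hor s p) (hlt₂ : hor s p < hor s q₂) :
    IsExt s P 1 p x ∨ IsExt s P (-1) p x := by
  refine (strict_of_hor_between hp h₁ h₂ hlt₁ hlt₂).imp (fun h => ⟨hp.2, fun y hy => ?_⟩)
    (fun h => ⟨hp.2, fun y hy => ?_⟩)
  all_goals
    rcases eq_or_ne y x with rfl | hne
    · exact le_rfl
    · have := h y hy hne
      linarith

lemma finite_nearest {P : Set Plane} (hP : P.Finite) (x : Plane) : (nearest P x).Finite :=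
  hP.subset fun _ h => h.1

lemma mem_vtx_iff {P : Set Plane} (hP : P.Finite) {x : Plane} :
    x ∈ vtx P ↔ 3 ≤ (nearest P x).ncard := by
  rw [vtx, mem_ofPred_eq, ← (finite_nearest hP x).cast_ncard_eq]
  norm_cast

lemma IsExt.mem_vtx {s : ℝ} {P : Set Plane} (hP : P.Finite) (hinj : InjOn (hor s) P)
    {p x : Plane} (hp : p ∈ P) {σ : ℝ} (hσ : σ ≠ 0) (h : IsExt s P σ p x) : x ∈ vtx P := by
  obtain ⟨q₁, hq₁, q₂, hq₂, hlt₁, hlt₂⟩ := h.exists_between hP hinj hp hσ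
  rw [mem_vtx_iff hP, ← Set.ncard_eq_three.2 ⟨q₁, p, q₂, ne_of_apply_ne _ hlt₁.ne,
    ne_of_apply_ne _ (hlt₁.trans hlt₂).ne, ne_of_apply_ne _ hlt₂.ne, rfl⟩]
  refine ncard_le_ncard ?_ (finite_nearest hP x)
  rintro q (rfl | rfl | rfl)
  exacts [hq₁, ⟨hp, h.1⟩, hq₂]

/-- At a vertex, all nearest generators except the two horizontal extremes have the vertex as the
top or the bottom of their cell. -/
lemma ncard_isExt_add_ncard_isExt {s : ℝ} {P : Set Plane} (hP : P.Finite)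
    (hinj : InjOn (hor s) P) {x : Plane} (hx : x ∈ vtx P) :
    {p ∈ P | IsExt s P 1 p x}.ncard + {p ∈ P | IsExt s P (-1) p x}.ncard + 2 =
      (nearest P x).ncard := by
  have hN := finite_nearest hP x
  have h3 := (mem_vtx_iff hP).1 hx
  have hnt : (nearest P x).Nontrivial := (one_lt_ncard_iff_nontrivial_and_finite.1 (by lia)).1
  obtain ⟨m, hm, M, hM, hmM, hmin, hmax⟩ :=
    exists_hor_extremes hN (hinj.mono fun _ h => h.1) hnt
  have hunion : {p ∈ P | IsExt s P 1 p x} ∪ {p ∈ P | IsExt s P (-1) p x} =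
      nearest P x \ {m, M} := by
    ext p
    constructor
    · have aux : ∀ σ : ℝ, σ ≠ 0 → p ∈ P → IsExt s P σ p x → p ∈ nearest P x \ {m, M} := by
        intro σ hσ hp h
        refine ⟨⟨hp, h.1⟩, ?_⟩
        rintro (rfl | rfl)
        · refine not_isExt_of_strict hP hσ (-1) (fun q hq hqp => ?_) h
          have := hmin q hq hqp
          linarith
        · refine not_isExt_of_strict hP hσ 1 (fun q hq hqp => ?_) h
          have := hmax q hq hqp
          linarith
      rintro (⟨hp, h⟩ | ⟨hp, h⟩)
      · exact aux 1 one_ne_zero hp h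
      · exact aux (-1) (by norm_num) hp h
    · rintro ⟨hp, hpmM⟩
      simp only [mem_insert_iff, mem_singleton_iff, not_or] at hpmM
      exact (isExt_or_of_between hp hm hM (hmin p hp hpmM.1) (hmax p hp hpmM.2)).imp
        (fun h => ⟨hp.1, h⟩) (fun h => ⟨hp.1, h⟩)
  have hdisj : Disjoint {p ∈ P | IsExt s P 1 p x} {p ∈ P | IsExt s P (-1) p x} :=
    disjoint_left.2 fun p h h' => h.2.not_neg hP hinj h.1 h'.2
  rw [← ncard_union_eq hdisj (hP.sep _) (hP.sep _), hunion, ← ncard_pair hmM]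
  refine ncard_sdiff_add_ncard_of_subset ?_ hN
  rintro q (rfl | rfl)
  exacts [hm, hM]

/-- The cell of `p` has a highest point unless an upward vector is normal at `p`. -/
lemma exists_isExt_iff {s : ℝ} {P : Set Plane} (hP : P.Finite) (hinj : InjOn (hor s) P)
    {p : Plane} (hp : p ∈ P) {σ : ℝ} (hσ : σ ≠ 0) :
    (∃ x, IsExt s P σ p x) ↔ ¬ ∃ a b, IsNormal s P p a b ∧ 0 < σ * b := by
  constructor
  · rintro ⟨x, hx, hmax⟩ ⟨a, b, hab, hb⟩
    have : pt s (hor s x + a) (ver s x + b) ∈ cell P p := by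
      rw [mem_cell_iff s] at hx ⊢
      intro q hq
      have h1 := hx q hq
      have h2 := hab q hq
      rw [hor_pt, ver_pt]
      linarith
    have h := hmax _ this
    rw [ver_pt] at h
    linarith
  · intro hno
    have hσσ : 0 < σ * σ := mul_self_pos.2 hσ
    have hne : {q ∈ P | hor s q < hor s p}.Nonempty := by
      by_contra hemp
      rw [not_nonempty_iff_eq_empty, sep_eq_empty_iff_mem_false] at hemp
      obtain ⟨ε, hε, hn⟩ := exists_isNormal_of_strict (s := s) (p := p) hP (-1) σ (by
        intro q hq hqp
        have := lt_of_le_of_ne (not_lt.1 (hemp q hq)) fun e => hqp (hinj hq hp e.symm)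
        linarith)
      exact hno ⟨_, _, hn, by nlinarith [mul_pos hε hσσ]⟩
    obtain ⟨q₁, ⟨hq₁, hlt₁⟩, hmax⟩ := exists_max_image _
      (fun q => -(σ * (ver s q - ver s p)) / (hor s q - hor s p)) (hP.sep _) hne
    set a := -(σ * (ver s q₁ - ver s p)) / (hor s q₁ - hor s p) with ha
    have hnot : ¬ IsNormal s P p a σ := fun h => hno ⟨a, σ, h, hσσ⟩
    simp only [IsNormal, not_forall, not_le] at hnot
    obtain ⟨q₂, hq₂, hpos⟩ := hnot
    have hlt₁' : hor s q₁ - hor s p < 0 := sub_neg.2 hlt₁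
    have ha₁ : a * (hor s q₁ - hor s p) + σ * (ver s q₁ - ver s p) = 0 := by
      rw [ha, div_mul_cancel₀ _ hlt₁'.ne]
      ring
    have hlt₂' : 0 < hor s q₂ - hor s p := by
      by_contra hcon
      rcases lt_or_eq_of_le (not_lt.1 hcon) with hlt | heq
      · have := hmax q₂ ⟨hq₂, sub_neg.1 hlt⟩
        rw [div_le_iff_of_neg hlt] at this
        linarith
      · rw [hinj hq₂ hp (sub_eq_zero.1 heq)] at hpos
        simp at hpos
    set K := σ * ((hor s q₂ - hor s p) * (ver s q₁ - ver s p) -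
      (hor s q₁ - hor s p) * (ver s q₂ - ver s p)) with hK
    have hKpos : 0 < K := by nlinarith
    set D : Plane → ℝ := fun q => ((hor s q - hor s p) ^ 2 + (ver s q - ver s p) ^ 2) / 2 with hD
    set B := σ ^ 2 * ((hor s q₂ - hor s p) * D q₁ - (hor s q₁ - hor s p) * D q₂) / K with hB
    set A : Plane → ℝ := fun q =>
      (D q + B * |(ver s q - ver s p) / σ|) / (hor s q - hor s p) with hA
    have hcell : ∀ y ∈ cell P p, ∀ q ∈ P, (hor s y - hor s p) * (hor s q - hor s p) +
        σ * (ver s y - ver s p) * ((ver s q - ver s p) / σ) ≤ D q := by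
      intro y hy q hq
      have h := (mem_cell_iff s).1 hy q hq
      have e : σ * (ver s y - ver s p) * ((ver s q - ver s p) / σ) =
        (ver s y - ver s p) * (ver s q - ver s p) := by field_simp
      rw [e]
      simp only [hD]
      linarith
    have hcpt : IsCompact (cell P p ∩ {y | σ * ver s p ≤ σ * ver s y}) := by
      have himg : IsCompact ((fun z : ℝ × ℝ => pt s (hor s p + z.1) (ver s p + z.2 / σ)) ''
          (Icc (A q₁) (A q₂) ×ˢ Icc 0 B)) := by
        refine (isCompact_Icc.prod isCompact_Icc).image ?_
        unfold pt
        fun_prop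
      refine himg.of_isClosed_subset ((isClosed_cell P p).inter
        (isClosed_le (by fun_prop) (by fun_prop))) ?_
      rintro y ⟨hy, hpy⟩
      have hpy' : σ * ver s p ≤ σ * ver s y := hpy
      have h₁ := hcell y hy q₁ hq₁
      have h₂ := hcell y hy q₂ hq₂
      set c := hor s y - hor s p with hc
      set e := σ * (ver s y - ver s p) with he
      have he0 : 0 ≤ e := by rw [he]; linarith
      have heB : e ≤ B := by
        rw [hB, le_div_iff₀ hKpos]
        have := add_le_add (mul_le_mul_of_nonneg_left h₁ hlt₂'.le)
          (mul_le_mul_of_nonneg_left h₂ (neg_nonneg.2 hlt₁'.le))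
        have := mul_le_mul_of_nonneg_left this (sq_nonneg σ)
        have e₁ : σ ^ 2 * ((ver s q₁ - ver s p) / σ) = σ * (ver s q₁ - ver s p) := by field_simp
        have e₂ : σ ^ 2 * ((ver s q₂ - ver s p) / σ) = σ * (ver s q₂ - ver s p) := by field_simp
        have e₃ : e * K = e * ((hor s q₂ - hor s p) * (σ ^ 2 * ((ver s q₁ - ver s p) / σ)) -
            (hor s q₁ - hor s p) * (σ ^ 2 * ((ver s q₂ - ver s p) / σ))) := by
          rw [e₁, e₂, hK]
          ring
        rw [e₃]
        linarith
      have hbound : ∀ r : ℝ, -(B * |r|) ≤ e * r := fun r => by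
        have h1 := mul_le_mul_of_nonneg_right heB (abs_nonneg r)
        have h2 := mul_le_mul_of_nonneg_left (neg_abs_le r) he0
        linarith
      refine ⟨(c, e), ⟨⟨?_, ?_⟩, he0, heB⟩, ?_⟩
      · simp only [hA]
        rw [div_le_iff_of_neg hlt₁']
        linarith [hbound ((ver s q₁ - ver s p) / σ)]
      · simp only [hA]
        rw [le_div_iff₀ hlt₂']
        linarith [hbound ((ver s q₂ - ver s p) / σ)]
      · refine eq_of_hor_of_ver (s := s) ?_ ?_
        · simp [hc]
        · simp [he, mul_div_cancel_left₀ _ hσ]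
    obtain ⟨x, ⟨hx, hpx⟩, hxmax⟩ := hcpt.exists_isMaxOn ⟨p, self_mem_cell P p, le_refl (σ * ver s p)⟩
      (f := fun y => σ * ver s y) (by fun_prop)
    refine ⟨x, hx, fun y hy => ?_⟩
    rcases le_total (σ * ver s p) (σ * ver s y) with h | h
    · exact hxmax ⟨hy, h⟩
    · exact h.trans hpx

/-- A linear functional on the plane in rotated coordinates. -/
lemma strongDual_apply_eq (s : ℝ) (f : StrongDual ℝ Plane) (x : Plane) :
    f x = f (pt s 1 0) * hor s x + f (pt s 0 1) * ver s x := by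
  have : x = hor s x • pt s 1 0 + ver s x • pt s 0 1 := by
    have hs : 1 + s ^ 2 ≠ 0 := by positivity
    ext i
    fin_cases i
    · simp [pt, hor, ver]
      field_simp
      ring
    · simp [pt, hor, ver]
      field_simp
      ring
  conv_lhs => rw [this]
  simp only [map_add, map_smul, smul_eq_mul]
  ring

lemma interior_convexHull_nonempty_of_not_collinear {P : Set Plane} (h : ¬ Collinear ℝ P) :
    (interior (convexHull ℝ P)).Nonempty := by
  have hne : P.Nonempty := by
    rw [nonempty_iff_ne_empty]
    rintro rfl
    exact h (collinear_empty ℝ Plane)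
  rw [interior_convexHull_nonempty_iff_affineSpan_eq_top,
    AffineSubspace.affineSpan_eq_top_iff_vectorSpan_eq_top_of_nonempty ℝ Plane Plane hne]
  rw [collinear_iff_finrank_le_one, not_le] at h
  refine Submodule.eq_top_of_finrank_eq (le_antisymm (Submodule.finrank_le _) ?_)
  rw [finrank_euclideanSpace_fin]
  exact h

lemma mem_Bd_iff (s : ℝ) {P : Set Plane} (hcol : ¬ Collinear ℝ P) {p : Plane} :
    p ∈ Bd P ↔ p ∈ P ∧ ∃ a b, (a ≠ 0 ∨ b ≠ 0) ∧ IsNormal s P p a b := by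
  refine and_congr_right fun hp => ?_
  have hsub := subset_convexHull ℝ P
  constructor
  · intro hfr
    obtain ⟨f, hf0, hf⟩ := geometric_hahn_banach_of_nonempty_interior_point
      (convex_convexHull ℝ P) hfr.2 (interior_convexHull_nonempty_of_not_collinear hcol)
    refine ⟨f (pt s 1 0), f (pt s 0 1), ?_, fun q hq => ?_⟩
    · by_contra! hcon
      refine hf0 (ContinuousLinearMap.ext fun x => ?_)
      rw [strongDual_apply_eq s, hcon.1, hcon.2]
      simp
    · have h := hf q (hsub hq)
      rw [strongDual_apply_eq s f q, strongDual_apply_eq s f p] at h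
      linarith
  · rintro ⟨a, b, hab, hn⟩
    refine ⟨subset_closure (hsub hp), fun hpint => ?_⟩
    have hhalf : convexHull ℝ P ⊆ {x | a * hor s x + b * ver s x ≤ a * hor s p + b * ver s p} := by
      refine convexHull_min (fun q hq => ?_) ?_
      · have := hn q hq
        simp only [mem_ofPred_eq]
        linarith
      · refine convex_halfSpace_le ⟨fun x y => ?_, fun c x => ?_⟩ _
        · simp only [hor, ver, PiLp.add_apply]
          ring
        · simp only [hor, ver, PiLp.smul_apply, smul_eq_mul]
          ring
    have hc : Tendsto (fun ε : ℝ => pt s (hor s p + ε * a) (ver s p + ε * b)) (𝓝[>] 0) (𝓝 p) := by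
      have : Tendsto (fun ε : ℝ => pt s (hor s p + ε * a) (ver s p + ε * b)) (𝓝 0)
          (𝓝 (pt s (hor s p + 0 * a) (ver s p + 0 * b))) := by
        refine Continuous.tendsto ?_ 0
        unfold pt
        fun_prop
      rw [zero_mul, zero_mul, add_zero, add_zero, pt_hor_ver] at this
      exact this.mono_left nhdsWithin_le_nhds
    obtain ⟨ε, h1, h2⟩ :=
      ((hc.eventually (mem_interior_iff_mem_nhds.1 hpint)).and self_mem_nhdsWithin).exists
    have h3 := hhalf h1
    simp only [mem_ofPred_eq, hor_pt, ver_pt] at h3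
    have h4 : (0 : ℝ) < ε := h2
    have h5 : 0 < a ^ 2 + b ^ 2 := by rcases hab with h | h <;> positivity
    nlinarith [mul_pos h4 h5]

lemma collinear_of_isNormal_neg {s : ℝ} {P : Set Plane} {p : Plane} (hp : p ∈ P) {a b : ℝ}
    (hb : b ≠ 0) (h : IsNormal s P p a b) (h' : IsNormal s P p (-a) (-b)) : Collinear ℝ P := by
  rw [collinear_iff_of_mem hp]
  refine ⟨pt s (-b) a, fun q hq => ⟨-(hor s q - hor s p) / b, ?_⟩⟩
  have e : a * (hor s q - hor s p) + b * (ver s q - ver s p) = 0 := by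
    have h1 := h q hq
    have h2 := h' q hq
    linarith
  have hsm : ∀ c : ℝ, c • pt s (-b) a = pt s (c * -b) (c * a) := by
    intro c
    ext i
    fin_cases i <;> simp [pt] <;> ring
  have hadd : ∀ c d : ℝ, hor s (pt s c d + p) = c + hor s p ∧
      ver s (pt s c d + p) = d + ver s p := by
    intro c d
    have h1 := hor_pt s c d
    have h2 := ver_pt s c d
    simp only [hor, ver, PiLp.add_apply] at h1 h2 ⊢
    constructor <;> linarith
  rw [hsm, vadd_eq_add]
  refine eq_of_hor_of_ver (s := s) ?_ ?_
  · rw [(hadd _ _).1]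
    field_simp
    ring
  · rw [(hadd _ _).2]
    field_simp
    linarith

/-- Each boundary point has a normal pointing up or down, and exactly the two horizontal extremes
have both. -/
lemma ncard_normal_add_ncard_normal {s : ℝ} {P : Set Plane} (hP : P.Finite)
    (hinj : InjOn (hor s) P) (hcol : ¬ Collinear ℝ P) :
    {p ∈ P | ∃ a b, IsNormal s P p a b ∧ 0 < 1 * b}.ncard +
      {p ∈ P | ∃ a b, IsNormal s P p a b ∧ 0 < -1 * b}.ncard = (Bd P).ncard + 2 := by
  have hnt : P.Nontrivial := by
    rw [← not_subsingleton_iff]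
    intro hsub
    rcases hsub.eq_empty_or_singleton with rfl | ⟨p, rfl⟩
    · exact hcol (collinear_empty ℝ Plane)
    · exact hcol (collinear_singleton ℝ p)
  obtain ⟨m, hm, M, hM, hmM, hmin, hmax⟩ := exists_hor_extremes hP hinj hnt
  have hMn : ∀ σ : ℝ, ∀ a > 0, ∃ ε > 0, IsNormal s P M a (ε * σ) := fun σ a ha =>
    exists_isNormal_of_strict hP a σ fun q hq hqM =>
      mul_neg_of_pos_of_neg ha (sub_neg.2 (hmax q hq hqM))
  have hmn : ∀ σ : ℝ, ∀ a < 0, ∃ ε > 0, IsNormal s P m a (ε * σ) := fun σ a ha =>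
    exists_isNormal_of_strict hP a σ fun q hq hqm =>
      mul_neg_of_neg_of_pos ha (sub_pos.2 (hmin q hq hqm))
  have heqM : ∀ p ∈ P, ∀ a > 0, IsNormal s P p a 0 → p = M := by
    intro p hp a ha h
    by_contra hne
    have h1 := h M hM
    have h2 := mul_pos ha (sub_pos.2 (hmax p hp hne))
    linarith
  have heqm : ∀ p ∈ P, ∀ a < 0, IsNormal s P p a 0 → p = m := by
    intro p hp a ha h
    by_contra hne
    have h1 := h m hm
    have h2 := mul_pos_of_neg_of_neg ha (sub_neg.2 (hmin p hp hne))
    linarith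
  rw [← ncard_union_add_ncard_inter _ _ (hP.sep _) (hP.sep _)]
  congr 1
  · congr 1
    ext p
    rw [mem_Bd_iff s hcol]
    constructor
    · rintro (⟨hp, a, b, hab, hb⟩ | ⟨hp, a, b, hab, hb⟩)
      · exact ⟨hp, a, b, Or.inr (by rintro rfl; simp at hb), hab⟩
      · exact ⟨hp, a, b, Or.inr (by rintro rfl; simp at hb), hab⟩
    · rintro ⟨hp, a, b, hne, hab⟩
      rcases lt_trichotomy b 0 with hb | rfl | hb
      · exact Or.inr ⟨hp, a, b, hab, by linarith⟩
      · left
        refine ⟨hp, ?_⟩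
        rcases lt_or_gt_of_ne (hne.resolve_right (by simp)) with ha | ha
        · obtain rfl := heqm p hp a ha hab
          obtain ⟨ε, hε, hn⟩ := hmn 1 a ha
          exact ⟨_, _, hn, by linarith⟩
        · obtain rfl := heqM p hp a ha hab
          obtain ⟨ε, hε, hn⟩ := hMn 1 a ha
          exact ⟨_, _, hn, by linarith⟩
      · exact Or.inl ⟨hp, a, b, hab, by linarith⟩
  · rw [← ncard_pair hmM]
    congr 1
    ext p
    constructor
    · rintro ⟨⟨hp, a, b, hab, hb⟩, -, a', b', hab', hb'⟩
      have hn : IsNormal s P p (b * a' - b' * a) 0 := by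
        intro q hq
        have h1 := mul_le_mul_of_nonneg_left (hab q hq) (show 0 ≤ -b' by linarith)
        have h2 := mul_le_mul_of_nonneg_left (hab' q hq) (show 0 ≤ b by linarith)
        linarith
      rcases lt_trichotomy (b * a' - b' * a) 0 with h | h | h
      · exact Or.inl (heqm p hp _ h hn)
      · refine absurd (collinear_of_isNormal_neg hp (show b ≠ 0 by rintro rfl; simp at hb) hab
          fun q hq => ?_) hcol
        have h1 := mul_le_mul_of_nonneg_left (hab' q hq) (show 0 ≤ b by linarith)
        have h2 : 0 < -b' := by linarith
        have h3 : b * (a' * (hor s q - hor s p) + b' * (ver s q - ver s p)) =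
            -b' * (-a * (hor s q - hor s p) + -b * (ver s q - ver s p)) := by
          linear_combination (hor s q - hor s p) * h
        rw [h3, mul_zero] at h1
        exact nonpos_of_mul_nonpos_right h1 h2
      · exact Or.inr (heqM p hp _ h hn)
    · rintro (rfl | rfl)
      · obtain ⟨ε, hε, hn⟩ := hmn 1 (-1) (by norm_num)
        obtain ⟨ε', hε', hn'⟩ := hmn (-1) (-1) (by norm_num)
        exact ⟨⟨hm, _, _, hn, by linarith⟩, hm, _, _, hn', by linarith⟩
      · obtain ⟨ε, hε, hn⟩ := hMn 1 1 one_pos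
        obtain ⟨ε', hε', hn'⟩ := hMn (-1) 1 one_pos
        exact ⟨⟨hM, _, _, hn, by linarith⟩, hM, _, _, hn', by linarith⟩

lemma finite_vtx {s : ℝ} {P : Set Plane} (hP : P.Finite) (hinj : InjOn (hor s) P) :
    (vtx P).Finite := by
  have hsub : ∀ p ∈ P, ∀ σ : ℝ, σ ≠ 0 → {x | IsExt s P σ p x}.Subsingleton :=
    fun p hp σ hσ x hx y hy => IsExt.unique hP hinj hp hσ hy hx
  refine (hP.biUnion fun p hp => ((hsub p hp 1 one_ne_zero).finite.union
    (hsub p hp (-1) (by norm_num)).finite)).subset fun x hx => ?_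
  have h := ncard_isExt_add_ncard_isExt hP hinj hx
  have h3 := (mem_vtx_iff hP).1 hx
  rw [mem_iUnion₂]
  by_contra! hcon
  have h₁ : {p ∈ P | IsExt s P 1 p x} = ∅ :=
    eq_empty_of_forall_notMem fun p hp => hcon p hp.1 (Or.inl hp.2)
  have h₂ : {p ∈ P | IsExt s P (-1) p x} = ∅ :=
    eq_empty_of_forall_notMem fun p hp => hcon p hp.1 (Or.inr hp.2)
  rw [h₁, h₂, ncard_empty] at h
  lia

/-- Counting pairs (generator, extreme point of its cell) by vertices and by generators. -/
lemma sum_ncard_isExt_add_ncard_normal {s : ℝ} {P : Set Plane} (hP : P.Finite) (hinj : InjOn (hor s) P)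
    {σ : ℝ} (hσ : σ ≠ 0) :
    ∑ x ∈ (finite_vtx hP hinj).toFinset, {p ∈ P | IsExt s P σ p x}.ncard +
      {p ∈ P | ∃ a b, IsNormal s P p a b ∧ 0 < σ * b}.ncard = P.ncard := by
  have hT : ∑ x ∈ (finite_vtx hP hinj).toFinset, {p ∈ P | IsExt s P σ p x}.ncard =
      {p ∈ P | ∃ x, IsExt s P σ p x}.ncard := by
    have hU : {p ∈ P | ∃ x, IsExt s P σ p x} =
        ⋃ x ∈ (finite_vtx hP hinj).toFinset, {p ∈ P | IsExt s P σ p x} := by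
      ext p
      simp only [mem_iUnion₂, Finite.mem_toFinset]
      constructor
      · rintro ⟨hp, x, hx⟩
        exact ⟨x, hx.mem_vtx hP hinj hp hσ, hp, hx⟩
      · rintro ⟨x, -, hp, hx⟩
        exact ⟨hp, x, hx⟩
    rw [hU, ← finsum_mem_coe_finset, Finite.coe_toFinset]
    simp only [Finite.mem_toFinset]
    rw [(finite_vtx hP hinj).ncard_biUnion (fun x _ => hP.sep _)]
    intro x _ y _ hxy
    exact disjoint_left.2 fun p h h' => hxy (IsExt.unique hP hinj h.1 hσ h'.2 h.2)
  have hC : {p ∈ P | ∃ x, IsExt s P σ p x} =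
      P \ {p ∈ P | ∃ a b, IsNormal s P p a b ∧ 0 < σ * b} := by
    ext p
    constructor
    · rintro ⟨hp, h⟩
      exact ⟨hp, fun h' => (exists_isExt_iff hP hinj hp hσ).1 h h'.2⟩
    · rintro ⟨hp, h⟩
      exact ⟨hp, (exists_isExt_iff hP hinj hp hσ).2 fun h' => h ⟨hp, h'⟩⟩
  rw [hT, hC]
  exact ncard_sdiff_add_ncard_of_subset (sep_subset _ _) hP

theorem card_vtx_formula (P : Set Plane) (hP : P.Finite)
    (hcol : ¬ Collinear ℝ P) :
    (vtx P).Finite ∧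
    ((vtx P).ncard : ℤ) = 2 * (P.ncard : ℤ) - ((Bd P).ncard : ℤ) - Ic P - 2 := by
  obtain ⟨s, hinj⟩ := exists_hor_injOn hP
  have hfin := finite_vtx hP hinj
  refine ⟨hfin, ?_⟩
  have hb := ncard_normal_add_ncard_normal hP hinj hcol
  have h₁ := sum_ncard_isExt_add_ncard_normal hP hinj one_ne_zero
  have h₂ := sum_ncard_isExt_add_ncard_normal hP hinj (show (-1 : ℝ) ≠ 0 by norm_num)
  have hloc : ∑ x ∈ hfin.toFinset, {p ∈ P | IsExt s P 1 p x}.ncard +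
      ∑ x ∈ hfin.toFinset, {p ∈ P | IsExt s P (-1) p x}.ncard + 2 * (vtx P).ncard =
      ∑ x ∈ hfin.toFinset, (nearest P x).ncard := by
    rw [ncard_eq_toFinset_card _ hfin, mul_comm, ← smul_eq_mul, ← Finset.sum_const,
      ← Finset.sum_add_distrib, ← Finset.sum_add_distrib]
    exact Finset.sum_congr rfl fun x hx =>
      ncard_isExt_add_ncard_isExt hP hinj (hfin.mem_toFinset.1 hx)
  have hI : Ic P = ∑ x ∈ hfin.toFinset, ((nearest P x).ncard : ℤ) - 3 * (vtx P).ncard := by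
    rw [Ic, finsum_mem_eq_finite_toFinset_sum _ hfin, Finset.sum_sub_distrib, Finset.sum_const,
      ncard_eq_toFinset_card _ hfin, nsmul_eq_mul, mul_comm]
  rw [hI, ← Nat.cast_sum]
  lia
end

section
/- Let P be a finite subset of the Euclidean plane ℝ² with P.ncard ≥ 5. Then for every n ≥ 1, (𝒱^[n](P)).ncard ≤ 2^n·(P.ncard − 5) + 5. -/
open Set

/-- The height function on the plane whose level lines have slope direction `(-t, 1)`. -/
def shearHeight (t : ℝ) (p : Plane) : ℝ := p 0 + t * p 1

/-- Twice the signed area of the triangle `a b d`. -/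
def turn (a b d : Plane) : ℝ := (d 0 - b 0) * (a 1 - b 1) - (a 0 - b 0) * (d 1 - b 1)

lemma exists_injOn_shearHeight {P : Set Plane} (hP : P.Finite) :
    ∃ t : ℝ, InjOn (shearHeight t) P := by
  have hbad : ((fun z : Plane × Plane => -(z.1 0 - z.2 0) / (z.1 1 - z.2 1)) '' (P ×ˢ P)).Finite :=
    (hP.prod hP).image _
  obtain ⟨t, ht⟩ := hbad.exists_notMem
  refine ⟨t, fun p hp q hq hpq => ?_⟩
  unfold shearHeight at hpq
  by_cases h1 : p 1 = q 1
  · have h0 : p 0 = q 0 := by rw [h1] at hpq; linarith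
    ext i
    fin_cases i
    exacts [h0, h1]
  · refine absurd ⟨(p, q), ⟨hp, hq⟩, ?_⟩ ht
    have : p 1 - q 1 ≠ 0 := sub_ne_zero.mpr h1
    simp only
    field_simp
    linarith

lemma dist_le_dist_iff_coords (x p q : Plane) :
    dist x p ≤ dist x q ↔
      (x 0 - p 0) ^ 2 + (x 1 - p 1) ^ 2 ≤ (x 0 - q 0) ^ 2 + (x 1 - q 1) ^ 2 := by
  rw [EuclideanSpace.dist_eq, EuclideanSpace.dist_eq, Real.sqrt_le_sqrt_iff (by positivity)]
  simp [Fin.sum_univ_two, Real.dist_eq, sq_abs]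

lemma nearest_sq_le {P : Set Plane} {x p q : Plane} (hp : p ∈ nearest P x) (hq : q ∈ P) :
    (x 0 - p 0) ^ 2 + (x 1 - p 1) ^ 2 ≤ (x 0 - q 0) ^ 2 + (x 1 - q 1) ^ 2 :=
  (dist_le_dist_iff_coords x p q).mp (hp.2 q hq)

lemma nearest_sq_eq {P : Set Plane} {x p q : Plane} (hp : p ∈ nearest P x)
    (hq : q ∈ nearest P x) :
    (x 0 - p 0) ^ 2 + (x 1 - p 1) ^ 2 = (x 0 - q 0) ^ 2 + (x 1 - q 1) ^ 2 :=
  le_antisymm (nearest_sq_le hp hq.1) (nearest_sq_le hq hp.1)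

/-- Three distinct points on a circle are not collinear. -/
lemma turn_ne_zero {P : Set Plane} {x a b d : Plane} (ha : a ∈ nearest P x)
    (hb : b ∈ nearest P x) (hd : d ∈ nearest P x) (hab : a ≠ b) (hdb : d ≠ b) (had : a ≠ d) :
    turn a b d ≠ 0 := by
  intro h
  have e1 := nearest_sq_eq ha hb
  have e2 := nearest_sq_eq hd hb
  have key : ∀ p q : Plane, p ≠ q → 0 < (p 0 - q 0) ^ 2 + (p 1 - q 1) ^ 2 := by
    intro p q hpq
    by_contra! hle
    apply hpq
    have h0 : p 0 - q 0 = 0 := by nlinarith [sq_nonneg (p 0 - q 0), sq_nonneg (p 1 - q 1)]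
    have h1 : p 1 - q 1 = 0 := by nlinarith [sq_nonneg (p 0 - q 0), sq_nonneg (p 1 - q 1)]
    ext i
    fin_cases i
    exacts [sub_eq_zero.mp h0, sub_eq_zero.mp h1]
  have k1 := key a b hab
  have k2 := key d b hdb
  have k3 := key a d had
  unfold turn at h
  generalize ev0 : a 0 - b 0 = v0 at *
  generalize ev1 : a 1 - b 1 = v1 at *
  generalize ew0 : d 0 - b 0 = w0 at *
  generalize ew1 : d 1 - b 1 = w1 at *
  generalize ez0 : x 0 - b 0 = z0 at *
  generalize ez1 : x 1 - b 1 = z1 at *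
  have f1 : v0 ^ 2 + v1 ^ 2 = 2 * (z0 * v0 + z1 * v1) := by subst_vars; linarith
  have f2 : w0 ^ 2 + w1 ^ 2 = 2 * (z0 * w0 + z1 * w1) := by subst_vars; linarith
  have k3' : 0 < (v0 - w0) ^ 2 + (v1 - w1) ^ 2 := by subst_vars; convert k3 using 1; ring
  have g1 : (v0 ^ 2 + v1 ^ 2) * (w0 ^ 2 + w1 ^ 2 - (v0 * w0 + v1 * w1)) = 0 := by
    linear_combination (v0 ^ 2 + v1 ^ 2) * f2 - (v0 * w0 + v1 * w1) * f1
      + 2 * (z0 * v1 - z1 * v0) * h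
  have g2 : (w0 ^ 2 + w1 ^ 2) * (v0 ^ 2 + v1 ^ 2 - (v0 * w0 + v1 * w1)) = 0 := by
    linear_combination (w0 ^ 2 + w1 ^ 2) * f1 - (v0 * w0 + v1 * w1) * f2
      - 2 * (z0 * w1 - z1 * w0) * h
  have g1' := (mul_eq_zero.mp g1).resolve_left k1.ne'
  have g2' := (mul_eq_zero.mp g2).resolve_left k2.ne'
  nlinarith

lemma turn_interpolate (t : ℝ) (B T a c d : Plane) :
    (shearHeight t d - shearHeight t c) * turn B a T
      + (shearHeight t c - shearHeight t a) * turn B d T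
      - (shearHeight t d - shearHeight t a) * turn B c T
      = -((shearHeight t T - shearHeight t B) * turn a c d) := by
  unfold shearHeight turn
  ring

lemma exists_nearest_sorted {P : Set Plane} {t : ℝ} (hP : P.Finite)
    (ht : InjOn (shearHeight t) P) {x : Plane} (hx : x ∈ vtx P) :
    ∃ a ∈ nearest P x, ∃ b ∈ nearest P x, ∃ d ∈ nearest P x,
      shearHeight t a < shearHeight t b ∧ shearHeight t b < shearHeight t d := by
  have hfin : (nearest P x).Finite := hP.subset fun p hp => hp.1
  have hcard : 2 < (nearest P x).ncard := by
    have h : (3 : ℕ∞) ≤ (nearest P x).encard := hx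
    rw [← hfin.cast_ncard_eq] at h
    exact_mod_cast h
  obtain ⟨a, b, d, ha, hb, hd, hab, had, hbd⟩ := (Set.two_lt_ncard_iff hfin).mp hcard
  have h1 := ht.ne ha.1 hb.1 hab
  have h2 := ht.ne ha.1 hd.1 had
  have h3 := ht.ne hb.1 hd.1 hbd
  rcases lt_or_gt_of_ne h1 with h1 | h1 <;> rcases lt_or_gt_of_ne h2 with h2 | h2 <;>
    rcases lt_or_gt_of_ne h3 with h3 | h3
  · exact ⟨a, ha, b, hb, d, hd, h1, h3⟩
  · exact ⟨a, ha, d, hd, b, hb, h2, h3⟩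
  · exact absurd (h1.trans h3) h2.not_gt
  · exact ⟨d, hd, a, ha, b, hb, h2, h1⟩
  · exact ⟨b, hb, a, ha, d, hd, h1, h2⟩
  · exact absurd (h1.trans h2) h3.not_gt
  · exact ⟨b, hb, d, hd, a, ha, h3, h2⟩
  · exact ⟨d, hd, b, hb, a, ha, h3, h1⟩

/-- `IsMiddle P t x b s` says that `b` is the middle point, with respect to height, of three
nearest generators of `x`, and that `s` records on which side of `b` the other two pass. -/
def IsMiddle (P : Set Plane) (t : ℝ) (x b : Plane) (s : SignType) : Prop :=
  b ∈ nearest P x ∧ ∃ a ∈ nearest P x, ∃ d ∈ nearest P x,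
    shearHeight t a < shearHeight t b ∧ shearHeight t b < shearHeight t d ∧
      SignType.sign (turn a b d) = s

/-- A Voronoi vertex is determined by a middle generator and its side. -/
lemma IsMiddle.unique {P : Set Plane} {t : ℝ} {x x' b : Plane} {s : SignType} (hs : s ≠ 0)
    (h : IsMiddle P t x b s) (h' : IsMiddle P t x' b s) : x = x' := by
  obtain ⟨hb, a, ha, d, hd, hab, hbd, hsg⟩ := h
  obtain ⟨hb', a', ha', d', hd', hab', hbd', hsg'⟩ := h'
  have e1 := nearest_sq_eq ha hb
  have e2 := nearest_sq_eq hd hb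
  have e3 := nearest_sq_eq ha' hb'
  have e4 := nearest_sq_eq hd' hb'
  have i1 := nearest_sq_le hb' ha.1
  have i2 := nearest_sq_le hb' hd.1
  have i3 := nearest_sq_le hb ha'.1
  have i4 := nearest_sq_le hb hd'.1
  obtain ⟨L, hL⟩ : ∃ L : Plane → ℝ, ∀ z,
      L z = (x' 0 - x 0) * (z 0 - b 0) + (x' 1 - x 1) * (z 1 - b 1) := ⟨_, fun _ => rfl⟩
  have la : L a ≤ 0 := by rw [hL]; linarith
  have ld : L d ≤ 0 := by rw [hL]; linarith
  have la' : 0 ≤ L a' := by rw [hL]; linarith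
  have ld' : 0 ≤ L d' := by rw [hL]; linarith
  have comb : ∀ a d : Plane, (shearHeight t d - shearHeight t b) * L a
      + (shearHeight t b - shearHeight t a) * L d
      = turn a b d * ((x' 1 - x 1) - t * (x' 0 - x 0)) := by
    intro a d
    simp only [hL, shearHeight, turn]
    ring
  have c1 := comb a d
  have c2 := comb a' d'
  have pa := mul_nonneg (sub_nonneg.mpr hbd.le) (neg_nonneg.mpr la)
  have pd := mul_nonneg (sub_nonneg.mpr hab.le) (neg_nonneg.mpr ld)
  have pa' := mul_nonneg (sub_nonneg.mpr hbd'.le) la'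
  have pd' := mul_nonneg (sub_nonneg.mpr hab'.le) ld'
  have m1 : turn a b d * ((x' 1 - x 1) - t * (x' 0 - x 0)) ≤ 0 := by linarith
  have m2 : 0 ≤ turn a' b d' * ((x' 1 - x 1) - t * (x' 0 - x 0)) := by linarith
  have hE : (x' 1 - x 1) - t * (x' 0 - x 0) = 0 := by
    rcases lt_trichotomy (turn a b d) 0 with hneg | hz | hpos
    · rw [sign_neg hneg] at hsg
      have hneg' : turn a' b d' < 0 := sign_eq_neg_one_iff.mp (hsg'.trans hsg.symm)
      exact le_antisymm (nonpos_of_mul_nonneg_right m2 hneg') (nonneg_of_mul_nonpos_right m1 hneg)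
    · rw [hz, sign_zero] at hsg
      exact absurd hsg.symm hs
    · rw [sign_pos hpos] at hsg
      have hpos' : 0 < turn a' b d' := sign_eq_one_iff.mp (hsg'.trans hsg.symm)
      exact le_antisymm (nonpos_of_mul_nonpos_right m1 hpos) (nonneg_of_mul_nonneg_right m2 hpos')
  rw [hE, mul_zero] at c1
  have hLa : L a = 0 := by
    have hz : (shearHeight t d - shearHeight t b) * L a = 0 := by linarith
    exact (mul_eq_zero.mp hz).resolve_left (sub_pos.mpr hbd).ne'
  have h0 : x' 0 - x 0 = 0 := by
    have hz : (x' 0 - x 0) * (shearHeight t a - shearHeight t b) = 0 := by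
      rw [hL] at hLa
      unfold shearHeight
      linear_combination hLa - (a 1 - b 1) * hE
    exact (mul_eq_zero.mp hz).resolve_right (sub_neg.mpr hab).ne
  have h1 : x' 1 - x 1 = 0 := by rw [h0] at hE; linarith
  ext i
  fin_cases i
  exacts [(sub_eq_zero.mp h0).symm, (sub_eq_zero.mp h1).symm]

lemma exists_isMiddle {P : Set Plane} {t : ℝ} (hP : P.Finite)
    (ht : InjOn (shearHeight t) P) {x : Plane} (hx : x ∈ vtx P) :
    ∃ z : Plane × SignType, z.2 ≠ 0 ∧ IsMiddle P t x z.1 z.2 := by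
  obtain ⟨a, ha, b, hb, d, hd, hab, hbd⟩ := exists_nearest_sorted hP ht hx
  refine ⟨(b, SignType.sign (turn a b d)), ?_, hb, a, ha, d, hd, hab, hbd, rfl⟩
  rw [Ne, sign_eq_zero_iff]
  refine turn_ne_zero ha hb hd ?_ ?_ ?_ <;> rintro rfl
  exacts [hab.false, hbd.false, (hab.trans hbd).false]

/-- Apart from the lowest point `B` and the highest point `T`, which are never middle points,
some generator is the middle point on at most one side. -/
lemma exists_missing_side {P : Set Plane} {t : ℝ} (hP : P.Finite)
    (ht : InjOn (shearHeight t) P) {x B T : Plane} (hx : x ∈ vtx P)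
    (hBT : shearHeight t B < shearHeight t T) :
    ∃ c ∈ P, c ≠ B ∧ c ≠ T ∧ ∃ s : SignType, s ≠ 0 ∧ ∀ y, ¬ IsMiddle P t y c s := by
  obtain ⟨⟨b, s⟩, hs, hb, a, ha, d, hd, -, -, hsg⟩ := exists_isMiddle hP ht hx
  obtain ⟨c, hc, hmax⟩ := exists_max_image P (fun z => |turn B z T|) hP ⟨b, hb.1⟩
  have hBT' := sub_pos.mpr hBT
  have hc0 : turn B c T ≠ 0 := by
    intro h0
    have hz : ∀ z ∈ P, turn B z T = 0 := fun z hz => by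
      have := hmax z hz
      simpa [h0] using this
    have hi := turn_interpolate t B T a b d
    rw [hz a ha.1, hz b hb.1, hz d hd.1] at hi
    have : turn a b d = 0 := by
      have h : (shearHeight t T - shearHeight t B) * turn a b d = 0 := by linarith
      exact (mul_eq_zero.mp h).resolve_left hBT'.ne'
    exact hs (hsg.symm.trans (by simp [this]))
  refine ⟨c, hc, ?_, ?_, SignType.sign (-turn B c T), ?_, ?_⟩
  · rintro rfl; exact hc0 (by unfold turn; ring)
  · rintro rfl; exact hc0 (by unfold turn; ring)
  · rw [Ne, sign_eq_zero_iff]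
    exact neg_ne_zero.mpr hc0
  · rintro y ⟨-, a, ha, d, hd, hac, hcd, hsg⟩
    have hi := turn_interpolate t B T a c d
    have ma := hmax a ha.1
    have md := hmax d hd.1
    have hac' := sub_pos.mpr hac
    have hcd' := sub_pos.mpr hcd
    rcases lt_or_gt_of_ne hc0 with hneg | hpos
    · rw [sign_pos (neg_pos.mpr hneg), sign_eq_one_iff] at hsg
      rw [abs_of_neg hneg] at ma md
      have pa := mul_nonneg hcd'.le (sub_nonneg.mpr (neg_le_of_abs_le ma))
      have pd := mul_nonneg hac'.le (sub_nonneg.mpr (neg_le_of_abs_le md))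
      have := mul_pos hBT' hsg
      nlinarith
    · rw [sign_neg (neg_neg_of_pos hpos), sign_eq_neg_one_iff] at hsg
      rw [abs_of_pos hpos] at ma md
      have pa := mul_nonneg hcd'.le (sub_nonneg.mpr (le_of_abs_le ma))
      have pd := mul_nonneg hac'.le (sub_nonneg.mpr (le_of_abs_le md))
      have := mul_neg_of_pos_of_neg hBT' hsg
      nlinarith

/-- A finite planar set of `n` points has at most `2 n - 5` Voronoi vertices. -/
lemma vtx_finite_and_ncard_le {P : Set Plane} (hP : P.Finite) :
    (vtx P).Finite ∧ ((vtx P).Nonempty → (vtx P).ncard + 5 ≤ 2 * P.ncard) := by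
  rcases (vtx P).eq_empty_or_nonempty with hV | ⟨x, hx⟩
  · simp [hV]
  obtain ⟨t, ht⟩ := exists_injOn_shearHeight hP
  obtain ⟨a, ha, b, hb, -, -, hab, -⟩ := exists_nearest_sorted hP ht hx
  obtain ⟨B, hB, hBmin⟩ := exists_min_image P (shearHeight t) hP ⟨a, ha.1⟩
  obtain ⟨T, hT, hTmax⟩ := exists_max_image P (shearHeight t) hP ⟨a, ha.1⟩
  have hBT : shearHeight t B < shearHeight t T :=
    (hBmin a ha.1).trans_lt (hab.trans_le (hTmax b hb.1))
  obtain ⟨c, hc, hcB, hcT, s, hs, hmiss⟩ := exists_missing_side hP ht hx hBT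
  choose! f hf0 hf using fun y (hy : y ∈ vtx P) => exists_isMiddle hP ht hy
  set S : Set (Plane × SignType) := ((P \ {B, T}) ×ˢ ({1, -1} : Set SignType)) \ {(c, s)} with hS
  have hSfin : S.Finite := ((hP.sdiff).prod (Set.toFinite _)).sdiff
  have hsign : ∀ s : SignType, s ≠ 0 → s ∈ ({1, -1} : Set SignType) := by
    intro s hs
    cases s <;> simp_all
  have hmaps : MapsTo f (vtx P) S := by
    intro y hy
    refine ⟨⟨⟨(hf y hy).1.1, ?_⟩, hsign _ (hf0 y hy)⟩, ?_⟩
    · obtain ⟨-, a, ha, d, hd, h1, h2, -⟩ := hf y hy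
      rintro (h | h)
      · rw [h] at h1
        exact (hBmin a ha.1).not_gt h1
      · rw [mem_singleton_iff.mp h] at h2
        exact (hTmax d hd.1).not_gt h2
    · intro h
      have h' := hf y hy
      rw [mem_singleton_iff.mp h] at h'
      exact hmiss y h'
  have hinj : InjOn f (vtx P) := by
    intro y hy z hz hyz
    have h' := hf z hz
    rw [← hyz] at h'
    exact (hf y hy).unique (hf0 y hy) h'
  refine ⟨Set.Finite.of_injOn hmaps hinj hSfin, fun _ => ?_⟩
  have hle := Set.ncard_le_ncard_of_injOn f hmaps hinj hSfin
  have hBTne : B ≠ T := fun h => hBT.ne (congrArg _ h)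
  have hsub : ({B, T} : Set Plane) ⊆ P := by
    rintro z (rfl | rfl)
    exacts [hB, hT]
  have hcS : (c, s) ∈ (P \ {B, T}) ×ˢ ({1, -1} : Set SignType) :=
    ⟨⟨hc, by simp [hcB, hcT]⟩, hsign s hs⟩
  have h1 := Set.ncard_sdiff_singleton_add_one hcS ((hP.sdiff).prod (Set.toFinite _))
  rw [← hS, Set.ncard_prod, Set.ncard_pair (by decide : (1 : SignType) ≠ -1)] at h1
  have h2 := Set.ncard_sdiff_add_ncard_of_subset hsub hP
  rw [Set.ncard_pair hBTne] at h2
  omega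

theorem upper_bound_iterates (P : Set Plane) (hP : P.Finite) (h5 : 5 ≤ P.ncard) :
    ∀ n : ℕ, 1 ≤ n →
      ((vtx^[n] P).ncard : ℤ) ≤ 2 ^ n * ((P.ncard : ℤ) - 5) + 5 := by
  have key : ∀ n : ℕ, (vtx^[n] P).Finite ∧
      ((vtx^[n] P).ncard : ℤ) ≤ 2 ^ n * ((P.ncard : ℤ) - 5) + 5 := by
    intro n
    induction n with
    | zero => simpa using hP
    | succ n ih =>
      rw [Function.iterate_succ_apply']
      obtain ⟨hfin, hle⟩ := vtx_finite_and_ncard_le ih.1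
      refine ⟨hfin, ?_⟩
      rcases (vtx (vtx^[n] P)).eq_empty_or_nonempty with hV | hV
      · have h : (0 : ℤ) ≤ (P.ncard : ℤ) - 5 := by omega
        rw [hV, Set.ncard_empty]
        positivity
      · have := hle hV
        rw [pow_succ]
        linarith [ih.2]
  exact fun n _ => (key n).2
end

section
/- Let P be a finite subset of the Euclidean plane ℝ². Then the number of points on the boundary of 𝒱(P) does not exceed the number of points on the boundary of P: (Bd(𝒱(P))).ncard ≤ (Bd(P)).ncard. -/
open Set

/-- The signed area of the parallelogram spanned by `q - p` and `r - p`. -/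
def orient (p q r : Plane) : ℝ :=
  (q 0 - p 0) * (r 1 - p 1) - (q 1 - p 1) * (r 0 - p 0)

/-- The square of the distance, in coordinates. -/
def distSq (x p : Plane) : ℝ :=
  (x 0 - p 0) ^ 2 + (x 1 - p 1) ^ 2

theorem dist_le_dist_iff_distSq (x p q : Plane) :
    dist x p ≤ dist x q ↔ distSq x p ≤ distSq x q := by
  rw [EuclideanSpace.dist_eq, EuclideanSpace.dist_eq, Real.sqrt_le_sqrt_iff (by positivity)]
  simp [Fin.sum_univ_two, Real.dist_eq, sq_abs, distSq]

theorem mem_nearest_iff {P : Set Plane} {x p : Plane} :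
    p ∈ nearest P x ↔ p ∈ P ∧ ∀ q ∈ P, distSq x p ≤ distSq x q := by
  simp [nearest, dist_le_dist_iff_distSq]

theorem distSq_eq_of_mem_nearest {P : Set Plane} {x p q : Plane} (hp : p ∈ nearest P x)
    (hq : q ∈ nearest P x) : distSq x p = distSq x q := by
  rw [mem_nearest_iff] at hp hq
  exact le_antisymm (hp.2 q hq.1) (hq.2 p hp.1)

theorem mem_vtx_iff_s10 {P : Set Plane} {x : Plane} :
    x ∈ vtx P ↔ ∃ p q r, p ∈ nearest P x ∧ q ∈ nearest P x ∧ r ∈ nearest P x ∧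
      p ≠ q ∧ p ≠ r ∧ q ≠ r := by
  constructor
  · intro h
    obtain ⟨t, ht, hcard⟩ := Set.exists_subset_encard_eq h
    obtain ⟨p, q, r, hpq, hpr, hqr, rfl⟩ := Set.encard_eq_three.1 hcard
    exact ⟨p, q, r, ht (by simp), ht (by simp), ht (by simp), hpq, hpr, hqr⟩
  · rintro ⟨p, q, r, hp, hq, hr, hpq, hpr, hqr⟩
    have hcard : ({p, q, r} : Set Plane).encard = 3 :=
      Set.encard_eq_three.2 ⟨p, q, r, hpq, hpr, hqr, rfl⟩
    refine hcard.symm.le.trans (Set.encard_le_encard ?_)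
    rintro z (rfl | rfl | rfl) <;> assumption

theorem exists_ne_mem_nearest {P : Set Plane} {x : Plane} (hx : x ∈ vtx P) (p q : Plane) :
    ∃ r ∈ nearest P x, r ≠ p ∧ r ≠ q := by
  obtain ⟨a, b, c, ha, hb, hc, hab, hac, hbc⟩ := mem_vtx_iff_s10.1 hx
  by_contra! h
  have := h a ha
  have := h b hb
  have := h c hc
  grind

theorem plane_ext {p q : Plane} (h0 : p 0 = q 0) (h1 : p 1 = q 1) : p = q := by
  ext i
  fin_cases i <;> assumption

theorem sq_add_sq_pos_of_ne {p q : Plane} (h : p ≠ q) :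
    0 < (q 0 - p 0) ^ 2 + (q 1 - p 1) ^ 2 := by
  by_contra! hle
  have h0 : (q 0 - p 0) ^ 2 = 0 := by nlinarith [sq_nonneg (q 0 - p 0), sq_nonneg (q 1 - p 1)]
  have h1 : (q 1 - p 1) ^ 2 = 0 := by nlinarith [sq_nonneg (q 0 - p 0), sq_nonneg (q 1 - p 1)]
  rw [sq_eq_zero_iff] at h0 h1
  exact h (plane_ext (by linarith) (by linarith))

theorem exists_eq_add_mul_of_orient_eq_zero {p q r : Plane} (hpq : p ≠ q)
    (h : orient p q r = 0) :
    ∃ c : ℝ, r 0 = p 0 + c * (q 0 - p 0) ∧ r 1 = p 1 + c * (q 1 - p 1) := by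
  have hL := (sq_add_sq_pos_of_ne hpq).ne'
  unfold orient at h
  refine ⟨((q 0 - p 0) * (r 0 - p 0) + (q 1 - p 1) * (r 1 - p 1)) /
    ((q 0 - p 0) ^ 2 + (q 1 - p 1) ^ 2), ?_, ?_⟩
  · field_simp
    linear_combination (-(q 1 - p 1)) * h
  · field_simp
    linear_combination (q 0 - p 0) * h

/-- Three distinct points of a circle are not collinear. -/
theorem orient_ne_zero {x p q r : Plane} (hq : distSq x p = distSq x q)
    (hr : distSq x p = distSq x r) (hpq : p ≠ q) (hrp : r ≠ p) (hrq : r ≠ q) :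
    orient p q r ≠ 0 := by
  intro h
  obtain ⟨c, h0, h1⟩ := exists_eq_add_mul_of_orient_eq_zero hpq h
  have hL := (sq_add_sq_pos_of_ne hpq).ne'
  unfold distSq at hq hr
  rw [h0, h1] at hr
  have : ((q 0 - p 0) ^ 2 + (q 1 - p 1) ^ 2) * (c * (c - 1)) = 0 := by
    linear_combination c * hq - hr
  rcases mul_eq_zero.1 ((mul_eq_zero.1 this).resolve_left hL) with hc | hc
  · exact hrp (plane_ext (by rw [h0, hc]; ring) (by rw [h1, hc]; ring))
  · have hc : c = 1 := by linarith
    exact hrq (plane_ext (by rw [h0, hc]; ring) (by rw [h1, hc]; ring))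

/-- Both `p` and `q` are nearest generators of `x`, and all of `P` lies to the left of the
oriented line from `p` to `q`. -/
def IsHullEdgeAt (P : Set Plane) (x p q : Plane) : Prop :=
  p ∈ nearest P x ∧ q ∈ nearest P x ∧ p ≠ q ∧ ∀ r ∈ P, 0 ≤ orient p q r

theorem IsHullEdgeAt.orient_pos {P : Set Plane} {x p q r : Plane} (h : IsHullEdgeAt P x p q)
    (hr : r ∈ nearest P x) (hrp : r ≠ p) (hrq : r ≠ q) : 0 < orient p q r :=
  lt_of_le_of_ne (h.2.2.2 r hr.1) (orient_ne_zero (distSq_eq_of_mem_nearest h.1 h.2.1)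
    (distSq_eq_of_mem_nearest h.1 hr) h.2.2.1 hrp hrq).symm

/-- The start of a hull edge determines its end. -/
theorem IsHullEdgeAt.right_unique {P : Set Plane} {x y p q q' : Plane} (hx : x ∈ vtx P)
    (h : IsHullEdgeAt P x p q) (h' : IsHullEdgeAt P y p q') : q = q' := by
  have hz : orient p q q' = 0 := by
    have h1 := h.2.2.2 q' h'.2.1.1
    have h2 := h'.2.2.2 q h.2.1.1
    unfold orient at *
    linarith
  obtain ⟨c, h0, h1⟩ := exists_eq_add_mul_of_orient_eq_zero h.2.2.1 hz
  have hL := sq_add_sq_pos_of_ne h.2.2.1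
  have hc : 0 < c := by
    obtain ⟨r, hr, hrp, hrq⟩ := exists_ne_mem_nearest hx p q
    have hpos := h.orient_pos hr hrp hrq
    have hnn := h'.2.2.2 r hr.1
    have hmul : orient p q' r = c * orient p q r := by
      unfold orient
      rw [h0, h1]
      ring
    rw [hmul] at hnn
    have hc0 : 0 ≤ c := nonneg_of_mul_nonneg_left hnn hpos
    refine lt_of_le_of_ne hc0 fun hc => h'.2.2.1 (plane_ext ?_ ?_)
    · rw [h0, ← hc]; ring
    · rw [h1, ← hc]; ring
  have hge : 1 ≤ c := by
    have e1 := distSq_eq_of_mem_nearest h.1 h.2.1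
    have e2 := (mem_nearest_iff.1 h.1).2 q' h'.2.1.1
    unfold distSq at e1 e2
    rw [h0, h1] at e2
    have : 0 ≤ (((q 0 - p 0) ^ 2 + (q 1 - p 1) ^ 2) * c) * (c - 1) := by
      linear_combination e2 - c * e1
    linarith [nonneg_of_mul_nonneg_right this (by positivity)]
  have hle : c ≤ 1 := by
    have e1 := distSq_eq_of_mem_nearest h'.1 h'.2.1
    have e2 := (mem_nearest_iff.1 h'.1).2 q h.2.1.1
    unfold distSq at e1 e2
    rw [h0, h1] at e1
    have : 0 ≤ (((q 0 - p 0) ^ 2 + (q 1 - p 1) ^ 2) * c) * (1 - c) := by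
      have := mul_le_mul_of_nonneg_left e2 hc.le
      linear_combination this - e1
    linarith [nonneg_of_mul_nonneg_right this (by positivity)]
  have hc1 : c = 1 := le_antisymm hle hge
  exact plane_ext (by rw [h0, hc1]; ring) (by rw [h1, hc1]; ring)

theorem IsHullEdgeAt.nonpos_of_mem_vtx {P : Set Plane} {x y p q : Plane} (hy : y ∈ vtx P)
    (h : IsHullEdgeAt P x p q) (h' : IsHullEdgeAt P y p q) {t : ℝ}
    (h0 : y 0 = x 0 + t * (q 1 - p 1)) (h1 : y 1 = x 1 - t * (q 0 - p 0)) : t ≤ 0 := by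
  obtain ⟨r, hr, hrp, hrq⟩ := exists_ne_mem_nearest hy p q
  have hpos := h'.orient_pos hr hrp hrq
  have e1 := distSq_eq_of_mem_nearest h'.1 hr
  have e2 := (mem_nearest_iff.1 h.1).2 r hr.1
  have : t * orient p q r ≤ 0 := by
    unfold distSq orient at *
    rw [h0, h1] at e1
    linear_combination (1 / 2) * e2 - (1 / 2) * e1
  exact nonpos_of_mul_nonpos_left this hpos

/-- A Voronoi vertex is determined by the unbounded edge starting at it. -/
theorem IsHullEdgeAt.left_unique {P : Set Plane} {x y p q : Plane} (hx : x ∈ vtx P)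
    (hy : y ∈ vtx P) (h : IsHullEdgeAt P x p q) (h' : IsHullEdgeAt P y p q) : x = y := by
  have hL := (sq_add_sq_pos_of_ne h.2.2.1).ne'
  have e1 := distSq_eq_of_mem_nearest h.1 h.2.1
  have e2 := distSq_eq_of_mem_nearest h'.1 h'.2.1
  obtain ⟨t, h0, h1⟩ : ∃ t : ℝ, y 0 = x 0 + t * (q 1 - p 1) ∧ y 1 = x 1 - t * (q 0 - p 0) := by
    unfold distSq at e1 e2
    refine ⟨((y 0 - x 0) * (q 1 - p 1) - (y 1 - x 1) * (q 0 - p 0)) /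
      ((q 0 - p 0) ^ 2 + (q 1 - p 1) ^ 2), ?_, ?_⟩
    · field_simp
      linear_combination (1 / 2) * (q 0 - p 0) * (e2 - e1)
    · field_simp
      linear_combination (1 / 2) * (q 1 - p 1) * (e2 - e1)
  have hle := h.nonpos_of_mem_vtx hy h' h0 h1
  have hge := h'.nonpos_of_mem_vtx hx h (t := -t) (by rw [h0]; ring) (by rw [h1]; ring)
  have ht : t = 0 := by linarith
  exact plane_ext (by rw [h0, ht]; ring) (by rw [h1, ht]; ring)

/-- From a Voronoi vertex some edge direction makes an acute angle with any given direction. -/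
theorem exists_edge_direction {P : Set Plane} (hP : P.Finite) {x : Plane} (hx : x ∈ vtx P)
    (a b : ℝ) (hab : 0 < a ^ 2 + b ^ 2) :
    ∃ p ∈ nearest P x, ∃ q ∈ nearest P x, p ≠ q ∧ ∃ c d : ℝ, 0 < a * c + b * d ∧
      c * (q 0 - p 0) + d * (q 1 - p 1) = 0 ∧
      ∀ r ∈ nearest P x, c * (r 0 - p 0) + d * (r 1 - p 1) ≤ 0 := by
  have hN : (nearest P x).Finite := hP.subset fun _ h => h.1
  obtain ⟨p₀, _, _, hp₀, -⟩ := mem_vtx_iff_s10.1 hx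
  obtain ⟨p, hp, hmax⟩ := Set.exists_max_image (nearest P x) (fun r => a * r 0 + b * r 1) hN
    ⟨p₀, hp₀⟩
  obtain ⟨e, f, hef, r₀, hr₀, hpos⟩ : ∃ e f : ℝ, a * e + b * f = 0 ∧
      ∃ r ∈ nearest P x, 0 < e * (r 0 - p 0) + f * (r 1 - p 1) := by
    by_contra! hcon
    obtain ⟨q, hq, hqp, -⟩ := exists_ne_mem_nearest hx p p
    obtain ⟨r, hr, hrp, hrq⟩ := exists_ne_mem_nearest hx p q
    have key : ∀ r ∈ nearest P x, b * (r 0 - p 0) - a * (r 1 - p 1) = 0 := fun r hr => by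
      have h1 := hcon b (-a) (by ring) r hr
      have h2 := hcon (-b) a (by ring) r hr
      linarith
    refine orient_ne_zero (distSq_eq_of_mem_nearest hp hq) (distSq_eq_of_mem_nearest hp hr)
      hqp.symm hrp hrq ?_
    have k1 := key q hq
    have k2 := key r hr
    have : (a ^ 2 + b ^ 2) * orient p q r = 0 := by
      unfold orient
      linear_combination (b * (r 1 - p 1) + a * (r 0 - p 0)) * k1 -
        (b * (q 1 - p 1) + a * (q 0 - p 0)) * k2
    exact (mul_eq_zero.1 this).resolve_left hab.ne'
  obtain ⟨q, ⟨hq, hqpos⟩, hmin⟩ := Set.exists_min_image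
    {r ∈ nearest P x | 0 < e * (r 0 - p 0) + f * (r 1 - p 1)}
    (fun r => (a * (p 0 - r 0) + b * (p 1 - r 1)) / (e * (r 0 - p 0) + f * (r 1 - p 1)))
    (hN.subset fun _ h => h.1) ⟨r₀, hr₀, hpos⟩
  dsimp only at hmin hmax
  set s := (a * (p 0 - q 0) + b * (p 1 - q 1)) / (e * (q 0 - p 0) + f * (q 1 - p 1)) with hs
  have hs0 : 0 ≤ s := div_nonneg (by linarith [hmax q hq]) hqpos.le
  have hsq : s * (e * (q 0 - p 0) + f * (q 1 - p 1)) = a * (p 0 - q 0) + b * (p 1 - q 1) :=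
    div_mul_cancel₀ _ hqpos.ne'
  refine ⟨p, hp, q, hq, ?_, a + s * e, b + s * f, ?_, ?_, ?_⟩
  · rintro rfl
    simp at hqpos
  · linear_combination hab - s * hef
  · linear_combination hsq
  · intro r hr
    rcases le_or_gt (e * (r 0 - p 0) + f * (r 1 - p 1)) 0 with hle | hlt
    · have := mul_nonpos_of_nonneg_of_nonpos hs0 hle
      linear_combination this + hmax r hr
    · have := (le_div_iff₀ hlt).1 (hmin r ⟨hr, hlt⟩)
      linear_combination this

/-- An edge leaving `x` in a direction in which `x` is maximal among the Voronoi vertices is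
unbounded. -/
theorem forall_mem_le_of_vtx_le {P : Set Plane} (hP : P.Finite) {x p q : Plane} {a b c d : ℝ}
    (hmax : ∀ y ∈ vtx P, a * y 0 + b * y 1 ≤ a * x 0 + b * x 1)
    (hp : p ∈ nearest P x) (hq : q ∈ nearest P x) (hpq : p ≠ q) (hacute : 0 < a * c + b * d)
    (hperp : c * (q 0 - p 0) + d * (q 1 - p 1) = 0)
    (hle : ∀ r ∈ nearest P x, c * (r 0 - p 0) + d * (r 1 - p 1) ≤ 0) :
    ∀ r ∈ P, c * (r 0 - p 0) + d * (r 1 - p 1) ≤ 0 := by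
  by_contra! hcon
  obtain ⟨r₀, hr₀, hpos⟩ := hcon
  obtain ⟨r, ⟨hr, hrpos⟩, hmin⟩ := Set.exists_min_image
    {r ∈ P | 0 < c * (r 0 - p 0) + d * (r 1 - p 1)}
    (fun r => (distSq x r - distSq x p) / (2 * (c * (r 0 - p 0) + d * (r 1 - p 1))))
    (hP.subset fun _ h => h.1) ⟨r₀, hr₀, hpos⟩
  dsimp only at hmin
  set t := (distSq x r - distSq x p) / (2 * (c * (r 0 - p 0) + d * (r 1 - p 1))) with ht
  have hgt : distSq x p < distSq x r := by
    refine lt_of_not_ge fun h => hrpos.not_ge (hle r (mem_nearest_iff.2 ⟨hr, fun z hz => ?_⟩))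
    exact h.trans ((mem_nearest_iff.1 hp).2 z hz)
  have ht0 : 0 < t := div_pos (by linarith) (by linarith)
  have htr : t * (2 * (c * (r 0 - p 0) + d * (r 1 - p 1))) = distSq x r - distSq x p :=
    div_mul_cancel₀ _ (by linarith)
  let y : Plane := !₂[x 0 + t * c, x 1 + t * d]
  have hy : ∀ z, distSq y z - distSq y p =
      distSq x z - distSq x p - t * (2 * (c * (z 0 - p 0) + d * (z 1 - p 1))) := fun z => by
    simp only [distSq, y, Matrix.cons_val_zero, Matrix.cons_val_one]
    ring
  have hyp : p ∈ nearest P y := mem_nearest_iff.2 ⟨hp.1, fun z hz => by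
    have hxz := (mem_nearest_iff.1 hp).2 z hz
    rcases le_or_gt (c * (z 0 - p 0) + d * (z 1 - p 1)) 0 with hle | hlt
    · have := mul_nonpos_of_nonneg_of_nonpos ht0.le hle
      linarith [hy z]
    · have := (le_div_iff₀ (by linarith)).1 (hmin z ⟨hz, hlt⟩)
      linarith [hy z]⟩
  have hmem : ∀ z ∈ P, distSq y z = distSq y p → z ∈ nearest P y := fun z hz h =>
    mem_nearest_iff.2 ⟨hz, fun w hw => h.le.trans ((mem_nearest_iff.1 hyp).2 w hw)⟩
  have hyq : q ∈ nearest P y := hmem q hq.1 (by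
    have := hy q
    rw [hperp] at this
    linarith [distSq_eq_of_mem_nearest hp hq])
  have hyr : r ∈ nearest P y := hmem r hr (by linarith [hy r])
  have hyv : y ∈ vtx P := mem_vtx_iff_s10.2 ⟨p, q, r, hyp, hyq, hyr, hpq,
    by rintro rfl; simp at hrpos, by rintro rfl; exact hrpos.ne' hperp⟩
  have h := hmax y hyv
  simp only [y, Matrix.cons_val_zero, Matrix.cons_val_one] at h
  have := mul_pos ht0 hacute
  linarith

theorem exists_isHullEdgeAt {P : Set Plane} (hP : P.Finite) {x : Plane} (hx : x ∈ vtx P)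
    {a b : ℝ} (hab : 0 < a ^ 2 + b ^ 2)
    (hmax : ∀ y ∈ vtx P, a * y 0 + b * y 1 ≤ a * x 0 + b * x 1) :
    ∃ p q, IsHullEdgeAt P x p q := by
  obtain ⟨p, hp, q, hq, hpq, c, d, hacute, hperp, hle⟩ := exists_edge_direction hP hx a b hab
  have hall := forall_mem_le_of_vtx_le hP hmax hp hq hpq hacute hperp hle
  have hL := sq_add_sq_pos_of_ne hpq
  have hcd : 0 < c ^ 2 + d ^ 2 := by
    by_contra! h
    have hc : c = 0 := by nlinarith [sq_nonneg c, sq_nonneg d]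
    have hd : d = 0 := by nlinarith [sq_nonneg c, sq_nonneg d]
    simp [hc, hd] at hacute
  set k := (q 1 - p 1) * c - (q 0 - p 0) * d with hk
  have hor : ∀ r, (c ^ 2 + d ^ 2) * orient p q r =
      -k * (c * (r 0 - p 0) + d * (r 1 - p 1)) := fun r => by
    unfold orient
    linear_combination (c * (r 1 - p 1) - d * (r 0 - p 0)) * hperp
  rcases le_total 0 k with h | h
  · refine ⟨p, q, hp, hq, hpq, fun r hr => nonneg_of_mul_nonneg_right ?_ hcd⟩
    rw [hor]
    exact mul_nonneg_of_nonpos_of_nonpos (by linarith) (hall r hr)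
  · refine ⟨q, p, hq, hp, hpq.symm, fun r hr => nonneg_of_mul_nonneg_right ?_ hcd⟩
    have : orient q p r = -orient p q r := by unfold orient; ring
    rw [this, mul_neg, hor]
    nlinarith [mul_nonneg_of_nonpos_of_nonpos h (hall r hr)]

/-- A point of a convex set off its interior has a supporting hyperplane. -/
theorem exists_supporting_functional {E : Type*} [NormedAddCommGroup E] [NormedSpace ℝ E]
    [FiniteDimensional ℝ E] {s : Set E} (hs : Convex ℝ s) {x : E} (hx : x ∈ s)
    (hxi : x ∉ interior s) : ∃ f : E →ₗ[ℝ] ℝ, f ≠ 0 ∧ ∀ y ∈ s, f y ≤ f x := by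
  rcases (interior s).eq_empty_or_nonempty with he | hne
  · have hspan : affineSpan ℝ s ≠ ⊤ := fun h => by
      rw [← hs.interior_nonempty_iff_affineSpan_eq_top, he] at h
      exact Set.not_nonempty_empty h
    have hdir : vectorSpan ℝ s < ⊤ := by
      rw [lt_top_iff_ne_top]
      intro h
      exact hspan ((AffineSubspace.affineSpan_eq_top_iff_vectorSpan_eq_top_of_nonempty
        ℝ E E ⟨x, hx⟩).2 h)
    obtain ⟨f, hf, hker⟩ := Submodule.exists_le_ker_of_lt_top _ hdir
    refine ⟨f, hf, fun y hy => le_of_eq ?_⟩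
    have := hker (vsub_mem_vectorSpan ℝ hy hx)
    rw [LinearMap.mem_ker, vsub_eq_sub, map_sub, sub_eq_zero] at this
    exact this
  · obtain ⟨f, hf⟩ := geometric_hahn_banach_open_point hs.interior isOpen_interior hxi
    refine ⟨f.toLinearMap, ?_, fun y hy => ?_⟩
    · obtain ⟨z, hz⟩ := hne
      intro h0
      have h := hf z hz
      have hz0 : f z = 0 := LinearMap.congr_fun h0 z
      have hx0 : f x = 0 := LinearMap.congr_fun h0 x
      linarith
    · have hcl : y ∈ closure (interior s) := by
        rw [hs.closure_interior_eq_closure_of_nonempty_interior hne]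
        exact subset_closure hy
      exact closure_minimal (fun z hz => (hf z hz).le)
        (isClosed_le f.continuous continuous_const) hcl

theorem exists_isHullEdgeAt_of_mem_Bd {P : Set Plane} (hP : P.Finite) {x : Plane}
    (hx : x ∈ Bd (vtx P)) : ∃ p q, IsHullEdgeAt P x p q := by
  obtain ⟨f, hf, hle⟩ := exists_supporting_functional (convex_convexHull ℝ (vtx P))
    (subset_convexHull ℝ _ hx.1) hx.2.2
  have hcoord : ∀ y : Plane, f y = f (EuclideanSpace.single 0 1) * y 0 +
      f (EuclideanSpace.single 1 1) * y 1 := fun y => by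
    have : y = y 0 • EuclideanSpace.single (0 : Fin 2) (1 : ℝ) +
        y 1 • EuclideanSpace.single (1 : Fin 2) (1 : ℝ) := by
      apply plane_ext <;> simp
    conv_lhs => rw [this]
    simp only [map_add, map_smul, smul_eq_mul]
    ring
  refine exists_isHullEdgeAt hP hx.1 (a := f (EuclideanSpace.single 0 1))
    (b := f (EuclideanSpace.single 1 1)) ?_ fun y hy => ?_
  · by_contra! h
    refine hf (LinearMap.ext fun y => ?_)
    have h0 : f (EuclideanSpace.single 0 1) = 0 := by
      nlinarith [sq_nonneg (f (EuclideanSpace.single 0 1)),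
        sq_nonneg (f (EuclideanSpace.single 1 1))]
    have h1 : f (EuclideanSpace.single 1 1) = 0 := by
      nlinarith [sq_nonneg (f (EuclideanSpace.single 0 1)),
        sq_nonneg (f (EuclideanSpace.single 1 1))]
    rw [hcoord, h0, h1]
    simp
  · rw [← hcoord, ← hcoord]
    exact hle y (subset_convexHull ℝ _ hy)

theorem IsHullEdgeAt.mem_Bd {P : Set Plane} {x p q : Plane} (h : IsHullEdgeAt P x p q) :
    p ∈ Bd P := by
  refine ⟨h.1.1, subset_closure (subset_convexHull ℝ _ h.1.1), fun hint => ?_⟩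
  have hconv : convexHull ℝ P ⊆ {z | 0 ≤ orient p q z} := by
    refine convexHull_min h.2.2.2 fun y hy z hz s t hs ht hst => ?_
    have hcomb : orient p q (s • y + t • z) = s * orient p q y + t * orient p q z := by
      obtain rfl : t = 1 - s := by linarith
      simp only [orient, PiLp.add_apply, PiLp.smul_apply, smul_eq_mul]
      ring
    change 0 ≤ orient p q (s • y + t • z)
    rw [hcomb]
    exact add_nonneg (mul_nonneg hs hy) (mul_nonneg ht hz)
  let d : Plane := !₂[q 1 - p 1, -(q 0 - p 0)]
  have hcont : Filter.Tendsto (fun t : ℝ => p + t • d) (nhds 0) (nhds p) := by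
    have : Continuous fun t : ℝ => p + t • d := by fun_prop
    simpa using this.tendsto 0
  have hev := (hcont.eventually (mem_interior_iff_mem_nhds.1 hint)).filter_mono
    (nhdsWithin_le_nhds (s := Set.Ioi 0))
  obtain ⟨t, ht, htpos⟩ := (hev.and self_mem_nhdsWithin).exists
  have hnn : 0 ≤ orient p q (p + t • d) := hconv ht
  have hval : orient p q (p + t • d) = -(t * ((q 0 - p 0) ^ 2 + (q 1 - p 1) ^ 2)) := by
    simp only [orient, d, PiLp.add_apply, PiLp.smul_apply, smul_eq_mul,
      Matrix.cons_val_zero, Matrix.cons_val_one]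
    ring
  rw [hval] at hnn
  linarith [mul_pos (Set.mem_Ioi.1 htpos) (sq_add_sq_pos_of_ne h.2.2.1)]

theorem bd_vtx_le_bd (P : Set Plane) (hP : P.Finite) :
    (Bd (vtx P)).ncard ≤ (Bd P).ncard := by
  have hex : ∀ x : Plane, ∃ p, x ∈ Bd (vtx P) → ∃ q, IsHullEdgeAt P x p q := fun x => by
    by_cases hx : x ∈ Bd (vtx P)
    · obtain ⟨p, hp⟩ := exists_isHullEdgeAt_of_mem_Bd hP hx
      exact ⟨p, fun _ => hp⟩
    · exact ⟨x, fun h => absurd h hx⟩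
  choose φ hφ using hex
  refine Set.ncard_le_ncard_of_injOn φ (fun x hx => ?_) (fun x hx y hy hxy => ?_)
    (hP.subset fun _ h => h.1)
  · obtain ⟨q, hq⟩ := hφ x hx
    exact hq.mem_Bd
  · obtain ⟨q, hq⟩ := hφ x hx
    obtain ⟨q', hq'⟩ := hφ y hy
    rw [← hxy] at hq'
    obtain rfl := hq.right_unique hx.1 hq'
    exact hq.left_unique hx.1 hy.1 hq'
end
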